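/- Let U > 0, let N_a and M be positive integers, let Λ_1,…,Λ_M ∈ ℝ, let I be a real number, and suppose k, k' ∈ [−π/2, π/2] satisfy N_a·k = 2π·I + Σ_{β=1}^M θ_U(2·sin k − 2Λ_β) and N_a·k' = 2π·(I+1) + Σ_{β=1}^M θ_U(2·sin k' − 2Λ_β). Then 0 < k' − k ≤ 2π/N_a. -/

import Mathlib

open Real

/-- The phase function `θ_U(x) = -2 arctan(2x/U)` of the Lieb–Wu equations. -/
noncomputable def theta (U x : ℝ) : ℝ := -2 * Real.arctan (2 * x / U)

theorem theta_antitone {U : ℝ} (hU : 0 ≤ U) : Antitone (theta U) := by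
  intro x y hxy
  have h : Real.arctan (2 * x / U) ≤ Real.arctan (2 * y / U) :=
    Real.arctan_mono (by gcongr)
  unfold theta
  linarith

/-- The total phase shift is antitone in the charge momentum on `[-π/2, π/2]`. -/
theorem antitoneOn_sum_theta {ι : Type*} [Fintype ι] {U : ℝ} (hU : 0 ≤ U) (Λ : ι → ℝ) :
    AntitoneOn (fun k => ∑ β, theta U (2 * Real.sin k - 2 * Λ β))
      (Set.Icc (-(π / 2)) (π / 2)) := by
  intro k hk k' hk' hkk'
  have hsin := Real.monotoneOn_sin hk hk' hkk'
  exact Finset.sum_le_sum fun β _ => theta_antitone hU (by linarith)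

/-- In the region `[-π/2, π/2]`, two consecutive charge momenta (quantum numbers `I`
and `I+1`) satisfy `0 < k' - k ≤ 2π/N_a`. -/
theorem consecutive_k_gap_in_central_region
    (U : ℝ) (hU : 0 < U) (Na M : ℕ) (hNa : 0 < Na) (hM : 0 < M)
    (Λ : Fin M → ℝ) (I : ℝ) (k k' : ℝ)
    (hk : k ∈ Set.Icc (-(π / 2)) (π / 2)) (hk' : k' ∈ Set.Icc (-(π / 2)) (π / 2))
    (h₁ : (Na : ℝ) * k = 2 * π * I
        + ∑ β : Fin M, theta U (2 * Real.sin k - 2 * Λ β))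
    (h₂ : (Na : ℝ) * k' = 2 * π * (I + 1)
        + ∑ β : Fin M, theta U (2 * Real.sin k' - 2 * Λ β)) :
    0 < k' - k ∧ k' - k ≤ 2 * π / (Na : ℝ) := by
  have hNa' : (0 : ℝ) < Na := Nat.cast_pos.mpr hNa
  have hlt : k < k' := by
    by_contra! h
    have hsum := antitoneOn_sum_theta hU.le Λ hk' hk h
    have hmul := mul_le_mul_of_nonneg_left h hNa'.le
    dsimp only at hsum
    linarith [Real.pi_pos]
  have hsum := antitoneOn_sum_theta hU.le Λ hk hk' hlt.le
  dsimp only at hsum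
  refine ⟨sub_pos.mpr hlt, ?_⟩
  rw [le_div_iff₀ hNa']
  linarith
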